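/- Let Λ = U³ ⊕ E8² ⊕ ⟨−2⟩ and let g ∈ Λ with B(g,g) = −2 and div_Λ(g) = 2. Then the orthogonal complement g^⊥ = {x ∈ Λ : B(g,x) = 0} is isometric to the K3 lattice U³ ⊕ E8². -/

import Mathlib

open Matrix

/-- The Gram pairing `(x, y) ↦ xᵀ G y` of an integer matrix `G`, as a bilinear map. -/
def gramBilin {n : ℕ} (G : Matrix (Fin n) (Fin n) ℤ) :
    (Fin n → ℤ) →ₗ[ℤ] (Fin n → ℤ) →ₗ[ℤ] ℤ :=
  Matrix.toLinearMap₂' ℤ G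

/-- The hyperbolic plane `U`, with Gram matrix `[[0,1],[1,0]]`. -/
def UGram : Matrix (Fin 2) (Fin 2) ℤ := !![0, 1; 1, 0]

/-- `U(2)`, with Gram matrix `[[0,2],[2,0]]`. -/
def U2Gram : Matrix (Fin 2) (Fin 2) ℤ := !![0, 2; 2, 0]

/-- `⟨2⟩ ⊕ ⟨-2⟩`. -/
def diag2Gram : Matrix (Fin 2) (Fin 2) ℤ := !![2, 0; 0, -2]

/-- The (negative definite even unimodular) `E8` lattice: the negative of the E₈ Cartan matrix. -/
def E8Gram : Matrix (Fin 8) (Fin 8) ℤ := -CartanMatrix.E₈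

/-- The rank-one lattice `⟨k⟩`. -/
def rankOneGram (k : ℤ) : Matrix (Fin 1) (Fin 1) ℤ := !![k]

/-- Orthogonal direct sum of two bilinear forms, on the product module. -/
def prodBilin {M N : Type*} [AddCommGroup M] [AddCommGroup N] [Module ℤ M] [Module ℤ N]
    (BM : M →ₗ[ℤ] M →ₗ[ℤ] ℤ) (BN : N →ₗ[ℤ] N →ₗ[ℤ] ℤ) :
    (M × N) →ₗ[ℤ] (M × N) →ₗ[ℤ] ℤ :=
  LinearMap.mk₂ ℤ (fun x y => BM x.1 y.1 + BN x.2 y.2)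
    (by intro m₁ m₂ n; simp [map_add]; ring)
    (by intro c m n; simp [_root_.map_smul, smul_eq_mul]; ring)
    (by intro m n₁ n₂; simp [map_add]; ring)
    (by intro c m n; simp [_root_.map_smul, smul_eq_mul]; ring)

/-- The underlying module of `Λ = U³ ⊕ E8² ⊕ ⟨-2⟩`. -/
abbrev LambdaM : Type :=
  (Fin 2 → ℤ) × (Fin 2 → ℤ) × (Fin 2 → ℤ) × (Fin 8 → ℤ) × (Fin 8 → ℤ) × (Fin 1 → ℤ)

/-- The bilinear form of the Beauville–Bogomolov lattice `Λ = U³ ⊕ E8² ⊕ ⟨-2⟩`. -/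
def LambdaB : LambdaM →ₗ[ℤ] LambdaM →ₗ[ℤ] ℤ :=
  prodBilin (gramBilin UGram) <| prodBilin (gramBilin UGram) <| prodBilin (gramBilin UGram) <|
    prodBilin (gramBilin E8Gram) <| prodBilin (gramBilin E8Gram) (gramBilin (rankOneGram (-2)))

/-- Membership in `O(Λ)`: a linear automorphism preserving the form. -/
def IsIsometry (f : LambdaM ≃ₗ[ℤ] LambdaM) : Prop :=
  ∀ x y, LambdaB (f x) (f y) = LambdaB x y

/-- The invariant sublattice `Λ^ι = {x | ι x = x}`. -/
def invLattice (f : LambdaM ≃ₗ[ℤ] LambdaM) : Submodule ℤ LambdaM :=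
  LinearMap.eqLocus (f : LambdaM →ₗ[ℤ] LambdaM) (LinearMap.id)

/-- A submodule of `Λ`, with the restricted form, is isometric to the lattice `(N, BN)`. -/
def IsometricTo {N : Type*} [AddCommGroup N] [Module ℤ N]
    (K : Submodule ℤ LambdaM) (BN : N →ₗ[ℤ] N →ₗ[ℤ] ℤ) : Prop :=
  ∃ e : K ≃ₗ[ℤ] N, ∀ x y : K, BN (e x) (e y) = LambdaB (x : LambdaM) (y : LambdaM)

/-- `div_Λ(v) = d`: the ideal of values `B(v, ·)` is generated by the positive integer `d`. -/
def HasDivisibility (v : LambdaM) (d : ℤ) : Prop :=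
  0 < d ∧ (∀ x, d ∣ LambdaB v x) ∧ ∃ x, LambdaB v x = d

/-- Conjugacy in `O(Λ)`: `ι' = γ ∘ ι ∘ γ⁻¹` for some isometry `γ`. -/
def ConjInO (ι ι' : LambdaM ≃ₗ[ℤ] LambdaM) : Prop :=
  ∃ γ : LambdaM ≃ₗ[ℤ] LambdaM, IsIsometry γ ∧ ∀ x, ι' x = γ (ι (γ.symm x))

/-- A sublattice has signature (1,1): rank two, containing both an element of positive
square and an element of negative square. -/
def SigOneOne (K : Submodule ℤ LambdaM) : Prop :=
  Module.finrank ℤ K = 2 ∧ (∃ x ∈ K, 0 < LambdaB x x) ∧ (∃ x ∈ K, LambdaB x x < 0)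

/-- The orthogonal complement of a submodule of `Λ`. -/
def perpOf (K : Submodule ℤ LambdaM) : Submodule ℤ LambdaM where
  carrier := {x | ∀ s ∈ K, LambdaB x s = 0}
  add_mem' := by
    intro a b ha hb s hs
    simp [map_add, LinearMap.add_apply, ha s hs, hb s hs]
  zero_mem' := by
    intro s hs
    simp
  smul_mem' := by
    intro c a ha s hs
    simp only [_root_.map_smul, LinearMap.smul_apply, ha s hs, smul_zero]

/-- The bilinear form of the K3 lattice `U³ ⊕ E8²`. -/
def K3B :
    ((Fin 2 → ℤ) × (Fin 2 → ℤ) × (Fin 2 → ℤ) × (Fin 8 → ℤ) × (Fin 8 → ℤ)) →ₗ[ℤ]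
      ((Fin 2 → ℤ) × (Fin 2 → ℤ) × (Fin 2 → ℤ) × (Fin 8 → ℤ) × (Fin 8 → ℤ)) →ₗ[ℤ] ℤ :=
  prodBilin (gramBilin UGram) <| prodBilin (gramBilin UGram) <| prodBilin (gramBilin UGram) <|
    prodBilin (gramBilin E8Gram) (gramBilin E8Gram)

/-- The vectors `v` and `v'` lie in the same orbit of the isometry group of the form `B`. -/
def SameOrbit {M : Type*} [AddCommGroup M] (B : M →ₗ[ℤ] M →ₗ[ℤ] ℤ) (v v' : M) :
    Prop :=
  ∃ φ : M ≃ₗ[ℤ] M, (∀ x y, B (φ x) (φ y) = B x y) ∧ φ v = v'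

lemma SameOrbit.trans {M : Type*} [AddCommGroup M] {B : M →ₗ[ℤ] M →ₗ[ℤ] ℤ}
    {u v w : M} (huv : SameOrbit B u v) (hvw : SameOrbit B v w) : SameOrbit B u w := by
  obtain ⟨φ, hφ, rfl⟩ := huv
  obtain ⟨ψ, hψ, rfl⟩ := hvw
  exact ⟨φ.trans ψ, fun x y => by simp [hφ, hψ], by simp⟩

/-- The Eichler transvection attached to `e` and `a`, where `q` is half the square of `a`. -/
def eichler {M : Type*} [AddCommGroup M] (B : M →ₗ[ℤ] M →ₗ[ℤ] ℤ) (e a : M) (q : ℤ) :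
    M →ₗ[ℤ] M :=
  LinearMap.id - (B a).smulRight e + (B e).smulRight a - (q • B e).smulRight e

lemma eichler_apply {M : Type*} [AddCommGroup M] (B : M →ₗ[ℤ] M →ₗ[ℤ] ℤ)
    (e a : M) (q : ℤ) (x : M) :
    eichler B e a q x = x - B a x • e + B e x • a - (q * B e x) • e := by
  simp [eichler]

lemma eichler_neg_eichler {M : Type*} [AddCommGroup M] {B : M →ₗ[ℤ] M →ₗ[ℤ] ℤ}
    (hB : ∀ x y, B x y = B y x) {e a : M} {q : ℤ} (hee : B e e = 0) (hea : B e a = 0)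
    (haa : B a a = 2 * q) (x : M) :
    eichler B e (-a) q (eichler B e a q x) = x := by
  have hae : B a e = 0 := by rw [hB, hea]
  simp only [eichler_apply, map_add, map_sub, map_neg, LinearMap.neg_apply, _root_.map_smul,
    hee, hea, hae, haa]
  module

/-- An Eichler transvection moves a vector inside its orbit. -/
lemma sameOrbit_eichler {M : Type*} [AddCommGroup M] {B : M →ₗ[ℤ] M →ₗ[ℤ] ℤ}
    (hB : ∀ x y, B x y = B y x) {e a : M} {q : ℤ} (hee : B e e = 0) (hea : B e a = 0)
    (haa : B a a = 2 * q) (v : M) :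
    SameOrbit B v (eichler B e a q v) := by
  have hae : B a e = 0 := by rw [hB, hea]
  refine ⟨LinearEquiv.ofLinearMap (eichler B e a q) (eichler B e (-a) q) ?_ ?_, ?_, rfl⟩
  · ext x
    have := eichler_neg_eichler (B := B) (a := -a) (q := q) hB hee (by simp [hea])
      (by simp [haa]) x
    simpa using this
  · ext x
    simpa using eichler_neg_eichler hB hee hea haa x
  · intro x y
    simp only [LinearEquiv.coe_ofLinearMap, eichler_apply, map_add, map_sub, _root_.map_smul,
      LinearMap.add_apply, LinearMap.sub_apply, LinearMap.smul_apply, smul_eq_mul, hee, hea, hae,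
      haa, hB x e, hB x a]
    ring

/-- Two orthogonal hyperbolic planes, spanned by `e, f` and by `e', f'`, orthogonal to `δ`. -/
structure HyperbolicFrame {M : Type*} [AddCommGroup M] (B : M →ₗ[ℤ] M →ₗ[ℤ] ℤ)
    (δ e f e' f' : M) : Prop where
  ee : B e e = 0
  ff : B f f = 0
  ef : B e f = 1
  ee₂ : B e' e' = 0
  ff₂ : B f' f' = 0
  ef₂ : B e' f' = 1
  e_e₂ : B e e' = 0
  e_f₂ : B e f' = 0
  f_e₂ : B f e' = 0
  f_f₂ : B f f' = 0
  eδ : B e δ = 0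
  fδ : B f δ = 0
  e₂δ : B e' δ = 0
  f₂δ : B f' δ = 0

namespace HyperbolicFrame

variable {M : Type*} [AddCommGroup M] {B : M →ₗ[ℤ] M →ₗ[ℤ] ℤ} {δ e f e' f' : M}

lemma swap (hB : ∀ x y, B x y = B y x) (h : HyperbolicFrame B δ e f e' f') :
    HyperbolicFrame B δ f e e' f' :=
  ⟨h.ff, h.ee, by rw [hB, h.ef], h.ee₂, h.ff₂, h.ef₂, h.f_e₂, h.f_f₂, h.e_e₂, h.e_f₂, h.fδ, h.eδ,
    h.e₂δ, h.f₂δ⟩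

lemma exchange (hB : ∀ x y, B x y = B y x) (h : HyperbolicFrame B δ e f e' f') :
    HyperbolicFrame B δ e' f' e f :=
  ⟨h.ee₂, h.ff₂, h.ef₂, h.ee, h.ff, h.ef, by rw [hB, h.e_e₂], by rw [hB, h.f_e₂],
    by rw [hB, h.e_f₂], by rw [hB, h.f_f₂], h.e₂δ, h.f₂δ, h.eδ, h.fδ⟩

end HyperbolicFrame

/-- If `v = 2w + cδ` has square `-2` and pairs to `±2` with an isotropic vector orthogonal to `δ`,
then `v` is in the orbit of `δ`. -/
lemma sameOrbit_of_isUnit {M : Type*} [AddCommGroup M] {B : M →ₗ[ℤ] M →ₗ[ℤ] ℤ}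
    (hB : ∀ x y, B x y = B y x) {δ e w : M} {b c : ℤ} (hδ : B δ δ = -2) (hee : B e e = 0)
    (heδ : B e δ = 0) (hwδ : B w δ = 0) (hew : B e w = b) (hb : b * b = 1)
    (hc : c ^ 2 = 1 + 2 * B w w) :
    SameOrbit B ((2 : ℤ) • w + c • δ) δ := by
  obtain ⟨m, rfl⟩ : Odd c := by
    have : Odd (c ^ 2) := ⟨B w w, by rw [hc]; ring⟩
    exact (Int.odd_pow' two_ne_zero).1 this
  have hδw : B δ w = 0 := by rw [hB, hwδ]
  have hwe : B w e = b := by rw [hB, hew]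
  set k : ℤ := -(b * m) with hk
  have hbk : b * k = -m := by linear_combination (-m) * hb + b * hk
  set w' : M := w + (k * (2 * m + 1) + k ^ 2 * b) • e with hw'
  have step := sameOrbit_eichler (B := B) (e := e) (a := k • δ) (q := -k ^ 2) hB hee
    (by simp [heδ]) (by simp [hδ]; ring) ((2 : ℤ) • w + (2 * m + 1) • δ)
  have heq : eichler B e (k • δ) (-k ^ 2) ((2 : ℤ) • w + (2 * m + 1) • δ) =
      (2 : ℤ) • w' + δ := by
    simp only [eichler_apply, map_add, _root_.map_smul, LinearMap.smul_apply, smul_eq_mul, hδ, heδ,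
      hδw, hew, hw']
    have h1 : (2 * b * k) • δ = (-(2 * m)) • δ := by congr 1; linear_combination 2 * hbk
    linear_combination (norm := module) h1
  rw [heq] at step
  refine step.trans ?_
  have hw'w' : B w' w' = 0 := by
    simp only [hw', map_add, _root_.map_smul, LinearMap.add_apply, LinearMap.smul_apply,
      smul_eq_mul, hee, hew, hwe]
    have : k ^ 2 = m ^ 2 := by rw [hk]; linear_combination m ^ 2 * hb
    have h2 : (2 : ℤ) * (B w w + 2 * ((k * (2 * m + 1) + k ^ 2 * b) * b)) = 0 := by
      linear_combination (-1) * hc + 4 * (2 * m + 1) * hbk + 4 * k ^ 2 * hb + 4 * this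
    linarith
  have hw'δ : B w' δ = 0 := by simp [hw', hwδ, heδ]
  have hδw' : B δ w' = 0 := by rw [hB, hw'δ]
  have last := sameOrbit_eichler (B := B) (e := w') (a := -δ) (q := -1) hB hw'w'
    (by simp [hw'δ]) (by simp [hδ]) ((2 : ℤ) • w' + δ)
  have heq' : eichler B w' (-δ) (-1) ((2 : ℤ) • w' + δ) = δ := by
    simp only [eichler_apply, map_add, map_neg, _root_.map_smul, LinearMap.neg_apply, hδ,
      hδw', hw'δ, hw'w']
    module
  rwa [heq'] at last

/-- Eichler's criterion for vectors of square `-2` and even divisibility, under the assumption that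
`v` pairs nontrivially with the first frame vector. -/
lemma HyperbolicFrame.sameOrbit_of_ne_zero {M : Type*} [AddCommGroup M]
    {B : M →ₗ[ℤ] M →ₗ[ℤ] ℤ} (hB : ∀ x y, B x y = B y x) (hEven : ∀ x, 2 ∣ B x x) {δ : M}
    (hδ : B δ δ = -2)
    (hdec : ∀ v, (∀ x, 2 ∣ B x v) → ∃ (w : M) (c : ℤ), v = (2 : ℤ) • w + c • δ ∧ B w δ = 0)
    (n : ℕ) {e f e' f' : M} (hF : HyperbolicFrame B δ e f e' f') {v : M}
    (hvv : B v v = -2) (hv : ∀ x, 2 ∣ B x v) {b : ℤ} (hb : B e v = 2 * b) (hb0 : b ≠ 0)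
    (hn : b.natAbs = n) :
    SameOrbit B v δ := by
  induction n using Nat.strong_induction_on generalizing e f e' f' v b with
  | _ n ih =>
  subst hn
  have reduce : ∀ {t : M} {q : ℤ}, B e t = 0 → B t t = 2 * q → ∀ {g g₁ g₂ g₃ : M},
      HyperbolicFrame B δ g g₁ g₂ g₃ → ∀ {s : ℤ},
      B g v - B t v * B g e + 2 * b * B g t - q * (2 * b) * B g e = 2 * (s % b) → ¬ b ∣ s →
      SameOrbit B v δ := by
    intro t q het htt g g₁ g₂ g₃ hG s hs hbs
    obtain ⟨φ, hφ, hφv⟩ := sameOrbit_eichler hB hF.ee het htt v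
    refine SameOrbit.trans ⟨φ, hφ, rfl⟩
      (ih (s % b).natAbs ?_ hG ?_ ?_ (b := s % b) ?_ ?_ rfl)
    · have h1 := Int.emod_nonneg s hb0
      have h2 := Int.emod_lt_abs s hb0
      zify
      rwa [abs_of_nonneg h1]
    · rw [hφ, hvv]
    · intro x
      rw [← φ.apply_symm_apply x, hφ]
      exact hv _
    · rw [hφv, ← hs, eichler_apply, hb]
      simp only [map_add, map_sub, _root_.map_smul, smul_eq_mul]
    · exact fun h => hbs (Int.dvd_of_emod_eq_zero h)
  obtain ⟨a, ha⟩ := hv f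
  obtain ⟨a', ha'⟩ := hv f'
  obtain ⟨b', hb'⟩ := hv e'
  have hfe : B f e = 1 := by rw [hB, hF.ef]
  have hfe₂ : B f' e' = 1 := by rw [hB, hF.ef₂]
  have he₂e : B e' e = 0 := by rw [hB, hF.e_e₂]
  have hf₂e : B f' e = 0 := by rw [hB, hF.e_f₂]
  by_cases hbb' : b ∣ b'
  swap
  · refine reduce (t := (-(b' / b)) • f') (q := 0) (by simp [hF.e_f₂]) (by simp [hF.ff₂])
      (hF.exchange hB) (s := b') ?_ hbb'
    simp only [_root_.map_smul, smul_eq_mul, he₂e, hF.ef₂, hb']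
    linear_combination (-2) * Int.emod_add_mul_ediv b' b
  by_cases hba' : b ∣ a'
  swap
  · refine reduce (t := (-(a' / b)) • e') (q := 0) (by simp [hF.e_e₂]) (by simp [hF.ee₂])
      ((hF.exchange hB).swap hB) (s := a') ?_ hba'
    simp only [_root_.map_smul, smul_eq_mul, hf₂e, hfe₂, ha']
    linear_combination (-2) * Int.emod_add_mul_ediv a' b
  obtain ⟨β, rfl⟩ := hbb'
  obtain ⟨α, rfl⟩ := hba'
  by_cases hz : ∃ (z : M) (r : ℤ), B e z = 0 ∧ B f z = 0 ∧ B z v = 2 * r ∧ ¬ b ∣ a - r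
  · obtain ⟨z, r, hez, hfz, hzv, hr⟩ := hz
    obtain ⟨q, hq⟩ := hEven z
    have hze' : B z e' = B e' z := hB _ _
    have hzf' : B z f' = B f' z := hB _ _
    set l : ℤ := 1 - β - B e' z with hl
    set m : ℤ := (a - r) / b - q - l * (α + B f' z) with hm
    refine reduce (t := z + m • e' + l • f')
      (q := q + m * l + m * B e' z + l * B f' z) ?_ ?_ (hF.swap hB) (s := a - r) ?_ hr
    · simp [hez, hF.e_e₂, hF.e_f₂]
    · simp only [map_add, _root_.map_smul, LinearMap.add_apply, LinearMap.smul_apply, smul_eq_mul,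
        hq, hze', hzf', hF.ee₂, hF.ff₂, hF.ef₂, hfe₂]
      ring
    · simp only [map_add, _root_.map_smul, LinearMap.add_apply, LinearMap.smul_apply, smul_eq_mul,
        ha, hzv, ha', hb', hfe, hfz, hF.f_e₂, hF.f_f₂]
      linear_combination (-2) * Int.emod_add_mul_ediv (a - r) b - 2 * b * hm - 2 * b * m * hl
  · push Not at hz
    have hba : b ∣ a := by simpa using hz 0 0 (by simp) (by simp) (by simp)
    have hbz : ∀ (z : M) (r : ℤ), B e z = 0 → B f z = 0 → B z v = 2 * r → b ∣ r :=
      fun z r h1 h2 h3 => (dvd_sub_right hba).1 (hz z r h1 h2 h3)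
    obtain ⟨w, c, rfl, hwδ⟩ := hdec v hv
    have hδw : B δ w = 0 := by rw [hB, hwδ]
    have hew : B e w = b := by
      simp only [map_add, _root_.map_smul, smul_eq_mul, hF.eδ] at hb
      linarith
    have hfw : B f w = a := by
      simp only [map_add, _root_.map_smul, smul_eq_mul, hF.fδ] at ha
      linarith
    have hc : c ^ 2 = 1 + 2 * B w w := by
      simp only [map_add, _root_.map_smul, LinearMap.add_apply, LinearMap.smul_apply, smul_eq_mul,
        hwδ, hδw, hδ] at hvv
      linarith
    have hbc : b ∣ -c := hbz δ (-c) hF.eδ hF.fδ (by simp [hδw, hδ]; ring)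
    have hbw : b ∣ B w w - 2 * (a * b) := by
      refine hbz (w - a • e - b • f) _ ?_ ?_ ?_
      · simp [hew, hF.ee, hF.ef]
      · simp [hfw, hF.ff, hfe]
      · simp only [map_add, map_sub, _root_.map_smul, LinearMap.sub_apply, LinearMap.smul_apply,
          smul_eq_mul, hwδ, hF.eδ, hF.fδ, hew, hfw]
        ring
    have hb1 : b ∣ 1 := by
      have h1 : b ∣ B w w := (dvd_sub_left (Dvd.intro_left (2 * a) (by ring))).1 hbw
      have h2 : b ∣ c ^ 2 := dvd_pow ((dvd_neg).1 hbc) two_ne_zero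
      have h3 : (1 : ℤ) = c ^ 2 - 2 * B w w := by linarith
      rw [h3]
      exact dvd_sub h2 (h1.mul_left 2)
    have hbb : b * b = 1 := Int.isUnit_mul_self (isUnit_of_dvd_one hb1)
    exact sameOrbit_of_isUnit hB hδ hF.ee hF.eδ hwδ hew hbb hc

/-- Eichler's criterion: in an even lattice containing two hyperbolic planes orthogonal to `δ`, all
vectors of square `-2` and even divisibility are in the orbit of `δ`, provided that they are all of
the form `2w + cδ`. -/
theorem HyperbolicFrame.sameOrbit {M : Type*} [AddCommGroup M]
    {B : M →ₗ[ℤ] M →ₗ[ℤ] ℤ} (hB : ∀ x y, B x y = B y x) (hEven : ∀ x, 2 ∣ B x x) {δ : M}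
    (hδ : B δ δ = -2)
    (hdec : ∀ v, (∀ x, 2 ∣ B x v) → ∃ (w : M) (c : ℤ), v = (2 : ℤ) • w + c • δ ∧ B w δ = 0)
    {e f e' f' : M} (hF : HyperbolicFrame B δ e f e' f') {v : M}
    (hvv : B v v = -2) (hv : ∀ x, 2 ∣ B x v) :
    SameOrbit B v δ := by
  obtain ⟨b, hb⟩ := hv e
  obtain ⟨a, ha⟩ := hv f
  rcases ne_or_eq b 0 with hb0 | rfl
  · exact hF.sameOrbit_of_ne_zero hB hEven hδ hdec _ hvv hv hb hb0 rfl
  rcases ne_or_eq a 0 with ha0 | rfl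
  · exact (hF.swap hB).sameOrbit_of_ne_zero hB hEven hδ hdec _ hvv hv ha ha0 rfl
  obtain ⟨φ, hφ, hφv⟩ := sameOrbit_eichler (q := -1) hB hF.ee hF.eδ (by simp [hδ]) v
  obtain ⟨w, c, hw, hwδ⟩ := hdec v hv
  have hδw : B δ w = 0 := by rw [hB, hwδ]
  have hδv : B δ v = -2 * c := by
    simp only [hw, map_add, _root_.map_smul, smul_eq_mul, hδw, hδ]
    ring
  have hc0 : c ≠ 0 := by
    rintro rfl
    simp only [hw, map_add, _root_.map_smul, LinearMap.add_apply, LinearMap.smul_apply, smul_eq_mul,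
      hwδ, hδw, hδ] at hvv
    omega
  refine SameOrbit.trans ⟨φ, hφ, rfl⟩
    ((hF.swap hB).sameOrbit_of_ne_zero hB hEven hδ hdec _ (b := c) ?_ ?_ ?_ hc0 rfl)
  · rw [hφ, hvv]
  · intro x
    rw [← φ.apply_symm_apply x, hφ]
    exact hv _
  · rw [hφv, eichler_apply]
    simp only [map_add, map_sub, _root_.map_smul, smul_eq_mul, hB f e, hF.ef, hF.fδ, ha, hb, hδv]
    ring

lemma gramBilin_UGram (x y : Fin 2 → ℤ) : gramBilin UGram x y = x 0 * y 1 + x 1 * y 0 := by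
  simp [gramBilin, UGram, Matrix.toLinearMap₂'_apply, Fin.sum_univ_two]

lemma gramBilin_rankOneGram (k : ℤ) (x y : Fin 1 → ℤ) :
    gramBilin (rankOneGram k) x y = k * (x 0 * y 0) := by
  simp [gramBilin, rankOneGram, Matrix.toLinearMap₂'_apply]
  ring

lemma gramBilin_E8Gram (x y : Fin 8 → ℤ) :
    gramBilin E8Gram x y =
      -2 * (x 0 * y 0 + x 1 * y 1 + x 2 * y 2 + x 3 * y 3 + x 4 * y 4 + x 5 * y 5 + x 6 * y 6
        + x 7 * y 7)
      + (x 0 * y 2 + x 2 * y 0) + (x 2 * y 3 + x 3 * y 2) + (x 1 * y 3 + x 3 * y 1)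
      + (x 3 * y 4 + x 4 * y 3) + (x 4 * y 5 + x 5 * y 4) + (x 5 * y 6 + x 6 * y 5)
      + (x 6 * y 7 + x 7 * y 6) := by
  simp [gramBilin, E8Gram, CartanMatrix.E₈, Matrix.toLinearMap₂'_apply, Fin.sum_univ_eight]
  ring

lemma LambdaB_apply (x y : LambdaM) :
    LambdaB x y = gramBilin UGram x.1 y.1 + (gramBilin UGram x.2.1 y.2.1
      + (gramBilin UGram x.2.2.1 y.2.2.1 + (gramBilin E8Gram x.2.2.2.1 y.2.2.2.1
      + (gramBilin E8Gram x.2.2.2.2.1 y.2.2.2.2.1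
      + gramBilin (rankOneGram (-2)) x.2.2.2.2.2 y.2.2.2.2.2)))) := rfl

lemma K3B_apply (x y : (Fin 2 → ℤ) × (Fin 2 → ℤ) × (Fin 2 → ℤ) × (Fin 8 → ℤ) × (Fin 8 → ℤ)) :
    K3B x y = gramBilin UGram x.1 y.1 + (gramBilin UGram x.2.1 y.2.1
      + (gramBilin UGram x.2.2.1 y.2.2.1 + (gramBilin E8Gram x.2.2.2.1 y.2.2.2.1
      + gramBilin E8Gram x.2.2.2.2 y.2.2.2.2))) := rfl

lemma LambdaB_symm (x y : LambdaM) : LambdaB x y = LambdaB y x := by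
  simp only [LambdaB_apply, gramBilin_UGram, gramBilin_E8Gram, gramBilin_rankOneGram]
  ring

lemma two_dvd_gramBilin_UGram_self (x : Fin 2 → ℤ) : 2 ∣ gramBilin UGram x x :=
  ⟨x 0 * x 1, by rw [gramBilin_UGram]; ring⟩

lemma two_dvd_gramBilin_E8Gram_self (x : Fin 8 → ℤ) : 2 ∣ gramBilin E8Gram x x :=
  ⟨-(x 0 * x 0 + x 1 * x 1 + x 2 * x 2 + x 3 * x 3 + x 4 * x 4 + x 5 * x 5 + x 6 * x 6 + x 7 * x 7)
    + x 0 * x 2 + x 2 * x 3 + x 1 * x 3 + x 3 * x 4 + x 4 * x 5 + x 5 * x 6 + x 6 * x 7, by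
      rw [gramBilin_E8Gram]; ring⟩

lemma two_dvd_LambdaB_self (x : LambdaM) : 2 ∣ LambdaB x x := by
  rw [LambdaB_apply]
  refine dvd_add (two_dvd_gramBilin_UGram_self _) <| dvd_add (two_dvd_gramBilin_UGram_self _) <|
    dvd_add (two_dvd_gramBilin_UGram_self _) <| dvd_add (two_dvd_gramBilin_E8Gram_self _) <|
    dvd_add (two_dvd_gramBilin_E8Gram_self _) ?_
  rw [gramBilin_rankOneGram]
  exact (Int.dvd_neg.2 dvd_rfl).mul_right _

lemma exists_two_smul_of_two_dvd {n : ℕ} {x : Fin n → ℤ} (h : ∀ i, 2 ∣ x i) :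
    ∃ y : Fin n → ℤ, x = (2 : ℤ) • y := by
  choose y hy using h
  exact ⟨y, by ext i; simp [hy]⟩

lemma exists_two_smul_of_two_dvd_gramBilin_UGram {x : Fin 2 → ℤ}
    (h : ∀ y, 2 ∣ gramBilin UGram y x) : ∃ y : Fin 2 → ℤ, x = (2 : ℤ) • y := by
  refine exists_two_smul_of_two_dvd ?_
  have h0 := h (Pi.single 0 1)
  have h1 := h (Pi.single 1 1)
  simp [gramBilin_UGram] at h0 h1
  simp [Fin.forall_fin_two, h0, h1]

lemma exists_two_smul_of_two_dvd_gramBilin_E8Gram {x : Fin 8 → ℤ}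
    (h : ∀ y, 2 ∣ gramBilin E8Gram y x) : ∃ y : Fin 8 → ℤ, x = (2 : ℤ) • y := by
  refine exists_two_smul_of_two_dvd ?_
  have h0 := h (Pi.single 0 1)
  have h1 := h (Pi.single 1 1)
  have h2 := h (Pi.single 2 1)
  have h3 := h (Pi.single 3 1)
  have h4 := h (Pi.single 4 1)
  have h5 := h (Pi.single 5 1)
  have h6 := h (Pi.single 6 1)
  have h7 := h (Pi.single 7 1)
  simp [gramBilin_E8Gram] at h0 h1 h2 h3 h4 h5 h6 h7
  intro i
  fin_cases i <;> simp <;> omega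

/-- The generator of the summand `⟨-2⟩` of `Λ`. -/
def LambdaDelta : LambdaM := (0, 0, 0, 0, 0, 1)

lemma LambdaB_LambdaDelta (x : LambdaM) : LambdaB LambdaDelta x = -2 * x.2.2.2.2.2 0 := by
  simp [LambdaB_apply, LambdaDelta, gramBilin_rankOneGram]

lemma exists_decomposition_of_two_dvd_LambdaB (v : LambdaM) (hv : ∀ x, 2 ∣ LambdaB x v) :
    ∃ (w : LambdaM) (c : ℤ), v = (2 : ℤ) • w + c • LambdaDelta ∧ LambdaB w LambdaDelta = 0 := by
  obtain ⟨v₁, v₂, v₃, v₄, v₅, v₆⟩ := v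
  obtain ⟨w₁, rfl⟩ := exists_two_smul_of_two_dvd_gramBilin_UGram (x := v₁) fun y => by
    simpa [LambdaB_apply] using hv (y, 0, 0, 0, 0, 0)
  obtain ⟨w₂, rfl⟩ := exists_two_smul_of_two_dvd_gramBilin_UGram (x := v₂) fun y => by
    simpa [LambdaB_apply] using hv (0, y, 0, 0, 0, 0)
  obtain ⟨w₃, rfl⟩ := exists_two_smul_of_two_dvd_gramBilin_UGram (x := v₃) fun y => by
    simpa [LambdaB_apply] using hv (0, 0, y, 0, 0, 0)
  obtain ⟨w₄, rfl⟩ := exists_two_smul_of_two_dvd_gramBilin_E8Gram (x := v₄) fun y => by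
    simpa [LambdaB_apply] using hv (0, 0, 0, y, 0, 0)
  obtain ⟨w₅, rfl⟩ := exists_two_smul_of_two_dvd_gramBilin_E8Gram (x := v₅) fun y => by
    simpa [LambdaB_apply] using hv (0, 0, 0, 0, y, 0)
  refine ⟨(w₁, w₂, w₃, w₄, w₅, 0), v₆ 0, ?_, ?_⟩
  · have : v₆ = v₆ 0 • (1 : Fin 1 → ℤ) := by
      ext i
      fin_cases i
      simp
    simpa [LambdaDelta] using this
  · rw [LambdaB_symm, LambdaB_LambdaDelta]
    simp

lemma hyperbolicFrame_LambdaB :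
    HyperbolicFrame LambdaB LambdaDelta (![1, 0], 0, 0, 0, 0, 0) (![0, 1], 0, 0, 0, 0, 0)
      (0, ![1, 0], 0, 0, 0, 0) (0, ![0, 1], 0, 0, 0, 0) := by
  constructor <;> simp [LambdaB_apply, LambdaDelta, gramBilin_UGram]

/-- The orthogonal complement of the generator of `⟨-2⟩` is the K3 lattice. -/
lemma isometricTo_ker_LambdaDelta : IsometricTo (LinearMap.ker (LambdaB LambdaDelta)) K3B := by
  have hmem : ∀ x : LinearMap.ker (LambdaB LambdaDelta), (x : LambdaM).2.2.2.2.2 = 0 := by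
    rintro ⟨x, hx⟩
    rw [LinearMap.mem_ker, LambdaB_LambdaDelta] at hx
    ext i
    fin_cases i
    simpa using hx
  refine ⟨
    { toFun := fun x => (x.1.1, x.1.2.1, x.1.2.2.1, x.1.2.2.2.1, x.1.2.2.2.2.1)
      map_add' := fun x y => rfl
      map_smul' := fun c x => rfl
      invFun := fun y => ⟨(y.1, y.2.1, y.2.2.1, y.2.2.2.1, y.2.2.2.2, 0), by
        simp [LambdaB_LambdaDelta]⟩
      left_inv := fun x => by
        have h := hmem x
        obtain ⟨⟨x₁, x₂, x₃, x₄, x₅, x₆⟩, hx⟩ := x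
        simp only at h
        subst h
        rfl
      right_inv := fun y => rfl }, fun x y => ?_⟩
  rw [LambdaB_apply, hmem x]
  simp [K3B_apply]

lemma IsometricTo.ker_of_sameOrbit {N : Type*} [AddCommGroup N] [Module ℤ N]
    {BN : N →ₗ[ℤ] N →ₗ[ℤ] ℤ} {v v' : LambdaM} (h : SameOrbit LambdaB v v')
    (h' : IsometricTo (LinearMap.ker (LambdaB v')) BN) :
    IsometricTo (LinearMap.ker (LambdaB v)) BN := by
  obtain ⟨φ, hφ, rfl⟩ := h
  obtain ⟨ψ, hψ⟩ := h'
  have hmap : (LinearMap.ker (LambdaB v)).map (φ : LambdaM →ₗ[ℤ] LambdaM) =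
      LinearMap.ker (LambdaB (φ v)) := by
    ext x
    rw [Submodule.mem_map_equiv, LinearMap.mem_ker, LinearMap.mem_ker, ← hφ, φ.apply_symm_apply]
  exact ⟨(φ.ofSubmodules _ _ hmap).trans ψ, fun x y => by simp [hψ, hφ]⟩

/-- If `g ∈ Λ = U³ ⊕ E8² ⊕ ⟨−2⟩` has `B(g,g) = −2` and `div_Λ(g) = 2`, then the orthogonal
complement `g^⊥ = {x ∈ Λ : B(g,x) = 0}` is isometric to the K3 lattice `U³ ⊕ E8²`. -/
theorem perp_of_div_two_is_K3_lattice
    (g : LambdaM) (hgsq : LambdaB g g = -2) (hdiv : HasDivisibility g 2) :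
    IsometricTo (LinearMap.ker (LambdaB g)) K3B := by
  refine IsometricTo.ker_of_sameOrbit ?_ isometricTo_ker_LambdaDelta
  refine hyperbolicFrame_LambdaB.sameOrbit LambdaB_symm two_dvd_LambdaB_self ?_
    exists_decomposition_of_two_dvd_LambdaB hgsq fun x => ?_
  · rw [LambdaB_LambdaDelta]
    simp [LambdaDelta]
  · rw [LambdaB_symm]
    exact hdiv.2.1 x
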